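/- For every positive integer m and nonnegative integer x, △_{2m}(x/(2m+2)) (interpreted as 0 if 2m+2 does not divide x) equals the sum, over all tuples (k_1,...,k_m,l_1,...,l_m) with k_i positive integers, l_i odd positive integers, k_1 l_1 + ... + k_m l_m = m(m+1)/2 + x, and k_i ≡ ±i (mod 2m+2) for each i, of (-1)^{|{i : k_i ≡ -i (mod 2m+2)}|}. -/

import Mathlib

/-- The number of ordered representations of `n` as a sum of `k` triangular numbers. -/
noncomputable def triangleReps (k n : ℕ) : ℕ :=
  Nat.card {f : Fin k → ℕ // (∑ i, f i * (f i + 1) / 2) = n}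

open Finset PowerSeries

/-- The triples `(u, d, e)` of integers with `d, e > 0` and `u ^ 2 + 4 * d * e = L`. -/
noncomputable def discTriples (L : ℤ) : Finset (ℤ × ℤ × ℤ) :=
  {t ∈ Icc (-L) L ×ˢ Icc 1 L ×ˢ Icc 1 L | t.1 ^ 2 + 4 * t.2.1 * t.2.2 = L}

theorem mem_discTriples {L u d e : ℤ} :
    (u, d, e) ∈ discTriples L ↔ 0 < d ∧ 0 < e ∧ u ^ 2 + 4 * d * e = L := by
  simp only [discTriples, mem_filter, mem_product, mem_Icc]
  refine ⟨fun h => ⟨by omega, by omega, h.2⟩, fun ⟨hd, he, h⟩ => ⟨⟨?_, ?_, ?_⟩, h⟩⟩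
  · constructor <;> nlinarith [mul_pos hd he, sq_nonneg (u - 1), sq_nonneg (u + 1)]
  · constructor <;> nlinarith [mul_pos hd he]
  · constructor <;> nlinarith [mul_pos hd he]

theorem sum_discTriples_eq_zero_of_odd {L : ℤ} (f : ℤ → ℤ → ℤ → ℤ)
    (hf : ∀ u d e, f (-u) d e = -f u d e) : ∑ t ∈ discTriples L, f t.1 t.2.1 t.2.2 = 0 := by
  have h : ∑ t ∈ discTriples L, f t.1 t.2.1 t.2.2 = ∑ t ∈ discTriples L, -f t.1 t.2.1 t.2.2 := by
    refine sum_nbij' (fun t => (-t.1, t.2)) (fun t => (-t.1, t.2)) ?_ ?_ ?_ ?_ ?_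
    · rintro ⟨u, d, e⟩ h
      rw [mem_discTriples] at h ⊢
      simpa using h
    · rintro ⟨u, d, e⟩ h
      rw [mem_discTriples] at h ⊢
      simpa using h
    · simp
    · simp
    · simp [hf]
  rw [sum_neg_distrib] at h
  omega

theorem sum_discTriples_swap {L : ℤ} (f : ℤ → ℤ → ℤ → ℤ) :
    ∑ t ∈ discTriples L, f t.1 t.2.1 t.2.2 = ∑ t ∈ discTriples L, f t.1 t.2.2 t.2.1 := by
  refine sum_nbij' (fun t => (t.1, t.2.2, t.2.1)) (fun t => (t.1, t.2.2, t.2.1)) ?_ ?_ ?_ ?_ ?_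
  · rintro ⟨u, d, e⟩ h
    rw [mem_discTriples] at h ⊢
    exact ⟨h.2.1, h.1, by linarith [h.2.2]⟩
  · rintro ⟨u, d, e⟩ h
    rw [mem_discTriples] at h ⊢
    exact ⟨h.2.1, h.1, by linarith [h.2.2]⟩
  · simp
  · simp
  · simp

theorem sum_discTriples_cubic_eq_zero {L : ℤ} (hL : ¬ IsSquare L) :
    ∑ t ∈ discTriples L, (t.2.1 + t.2.2) * (t.2.1 + t.1) * (t.2.2 - t.1) = 0 := by
  set G : ℤ × ℤ × ℤ → ℤ := fun t => (t.2.1 + t.2.2) * (t.2.1 + t.1) * (t.2.2 - t.1) with hG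
  have hA : ∑ t ∈ discTriples L with t.1 + t.2.1 < t.2.2, G t = 0 := by
    have h : ∑ t ∈ discTriples L with t.1 + t.2.1 < t.2.2, G t =
        ∑ t ∈ discTriples L with t.1 + t.2.1 < t.2.2, -G t := by
      refine sum_nbij' (fun t => (-t.1 - 2 * t.2.1, t.2.1, t.2.2 - t.1 - t.2.1))
        (fun t => (-t.1 - 2 * t.2.1, t.2.1, t.2.2 - t.1 - t.2.1)) ?_ ?_ ?_ ?_ ?_
      · rintro ⟨u, d, e⟩ h
        simp only [mem_filter, mem_discTriples] at h ⊢
        exact ⟨⟨h.1.1, by linarith, by linear_combination h.1.2.2⟩, by linarith⟩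
      · rintro ⟨u, d, e⟩ h
        simp only [mem_filter, mem_discTriples] at h ⊢
        exact ⟨⟨h.1.1, by linarith, by linear_combination h.1.2.2⟩, by linarith⟩
      · rintro ⟨u, d, e⟩ h
        ext <;> dsimp only <;> ring
      · rintro ⟨u, d, e⟩ h
        ext <;> dsimp only <;> ring
      · rintro ⟨u, d, e⟩ h
        simp only [hG]
        ring
    rw [sum_neg_distrib] at h
    omega
  have hC : ∑ t ∈ discTriples L with ¬ t.1 + t.2.1 < t.2.2, G t =
      ∑ t ∈ discTriples L with t.1 + t.2.1 < t.2.2, G t := by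
    refine sum_nbij' (fun t => (-t.1, t.2.2, t.2.1)) (fun t => (-t.1, t.2.2, t.2.1)) ?_ ?_ ?_ ?_ ?_
    · rintro ⟨u, d, e⟩ h
      simp only [mem_filter, mem_discTriples] at h ⊢
      refine ⟨⟨h.1.2.1, h.1.1, by linarith [h.1.2.2]⟩, ?_⟩
      have hne : u + d ≠ e := by
        rintro rfl
        exact hL ⟨u + 2 * d, by linear_combination -h.1.2.2⟩
      omega
    · rintro ⟨u, d, e⟩ h
      simp only [mem_filter, mem_discTriples] at h ⊢
      exact ⟨⟨h.1.2.1, h.1.1, by linarith [h.1.2.2]⟩, by omega⟩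
    · simp
    · simp
    · rintro ⟨u, d, e⟩ h
      simp only [hG]
      ring
  rw [← sum_filter_add_sum_filter_not _ (fun t => t.1 + t.2.1 < t.2.2), hC, hA, add_zero]

theorem sum_discTriples_eq_zero {L : ℤ} (hL : ¬ IsSquare L) :
    ∑ t ∈ discTriples L, t.2.1 * (t.2.1 * t.2.2 - t.1 ^ 2) = 0 := by
  have h₁ := sum_discTriples_cubic_eq_zero hL
  have h₂ := sum_discTriples_eq_zero_of_odd (L := L) (fun u d e => u * (e ^ 2 - d ^ 2))
    (fun u d e => by ring)
  have h₃ := sum_discTriples_swap (L := L) (fun u d e => d * (d * e - u ^ 2))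
  have h₄ : ∑ t ∈ discTriples L, (t.2.1 + t.2.2) * (t.2.1 + t.1) * (t.2.2 - t.1) =
      ∑ t ∈ discTriples L, t.2.1 * (t.2.1 * t.2.2 - t.1 ^ 2) +
      ∑ t ∈ discTriples L, t.2.2 * (t.2.2 * t.2.1 - t.1 ^ 2) +
      ∑ t ∈ discTriples L, t.1 * (t.2.2 ^ 2 - t.2.1 ^ 2) := by
    rw [← sum_add_distrib, ← sum_add_distrib]
    exact sum_congr rfl fun t _ => by ring
  omega

theorem sum_discTriples_pos_eq_zero {L : ℤ} (hL : ¬ IsSquare L) (hodd : Odd L) :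
    ∑ t ∈ discTriples L with 0 < t.1, t.2.1 * (t.2.1 * t.2.2 - t.1 ^ 2) = 0 := by
  have h := sum_discTriples_eq_zero hL
  rw [← sum_filter_add_sum_filter_not _ (fun t => 0 < t.1)] at h
  have h' : ∑ t ∈ discTriples L with ¬ 0 < t.1, t.2.1 * (t.2.1 * t.2.2 - t.1 ^ 2) =
      ∑ t ∈ discTriples L with 0 < t.1, t.2.1 * (t.2.1 * t.2.2 - t.1 ^ 2) := by
    refine sum_nbij' (fun t => (-t.1, t.2)) (fun t => (-t.1, t.2)) ?_ ?_ ?_ ?_ ?_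
    · rintro ⟨u, d, e⟩ h
      simp only [mem_filter, mem_discTriples] at h ⊢
      refine ⟨⟨h.1.1, h.1.2.1, by linarith [h.1.2.2]⟩, ?_⟩
      have hne : u ≠ 0 := by
        rintro rfl
        obtain ⟨r, rfl⟩ := hodd
        have := h.1.2.2
        rw [mul_assoc] at this
        omega
      omega
    · rintro ⟨u, d, e⟩ h
      simp only [mem_filter, mem_discTriples] at h ⊢
      exact ⟨⟨h.1.1, h.1.2.1, by linarith [h.1.2.2]⟩, by omega⟩
    · simp
    · simp
    · simp
  omega

/-- The generating function of the triangular numbers. -/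
noncomputable def triangleSeries : ℤ⟦X⟧ :=
  PowerSeries.mk fun n => (#{k ∈ range (n + 1) | k * (k + 1) / 2 = n} : ℤ)

/-- The generating function of the divisor sums of the odd numbers. -/
noncomputable def oddSigmaSeries : ℤ⟦X⟧ :=
  PowerSeries.mk fun n => ∑ d ∈ (2 * n + 1).divisors, (d : ℤ)

theorem two_mul_triangle (k : ℕ) : 2 * (k * (k + 1) / 2) = k * (k + 1) :=
  Nat.mul_div_cancel' (Nat.even_mul_succ_self k).two_dvd

theorem le_triangle (k : ℕ) : k ≤ k * (k + 1) / 2 := by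
  have := two_mul_triangle k
  rcases k with _ | k
  · simp
  · nlinarith

theorem coeff_triangleSeries {a n : ℕ} (h : a ≤ n) :
    coeff a triangleSeries = ∑ k ∈ range (n + 1), if k * (k + 1) / 2 = a then 1 else 0 := by
  rw [triangleSeries, coeff_mk, card_filter]
  push_cast
  refine sum_subset (range_subset_range.2 (by omega)) fun k _ hk => if_neg fun hka => hk ?_
  have := le_triangle k
  simp only [mem_range]
  omega

theorem sum_antidiagonal_triangle_oddSigma (n : ℕ) :
    ∑ p ∈ antidiagonal n, coeff p.1 triangleSeries *
      (((p.2 : ℤ) - 4 * p.1) * coeff p.2 oddSigmaSeries) = 0 := by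
  have hL : ¬ IsSquare (8 * n + 5 : ℤ) := by
    rintro ⟨r, hr⟩
    have h8 : r % 8 = 0 ∨ r % 8 = 1 ∨ r % 8 = 2 ∨ r % 8 = 3 ∨ r % 8 = 4 ∨ r % 8 = 5 ∨ r % 8 = 6 ∨
      r % 8 = 7 := by omega
    have := congrArg (· % 8) hr
    rcases h8 with h | h | h | h | h | h | h | h <;> simp [Int.mul_emod, Int.add_emod, h] at this
  have key := sum_discTriples_pos_eq_zero hL ⟨4 * n + 2, by ring⟩
  have h1 : 2 * ∑ p ∈ antidiagonal n, coeff p.1 triangleSeries *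
      (((p.2 : ℤ) - 4 * p.1) * coeff p.2 oddSigmaSeries) =
      ∑ t ∈ antidiagonal n ×ˢ range (n + 1) ×ˢ range (2 * n + 2) with
        t.2.1 * (t.2.1 + 1) / 2 = t.1.1 ∧ t.2.2 ∈ (2 * t.1.2 + 1).divisors,
        2 * (((t.1.2 : ℤ) - 4 * t.1.1) * t.2.2) := by
    rw [sum_filter, sum_product, mul_sum]
    refine sum_congr rfl fun p hp => ?_
    rw [HasAntidiagonal.mem_antidiagonal] at hp
    rw [coeff_triangleSeries (show p.1 ≤ n by omega), sum_product, sum_mul, mul_sum]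
    refine sum_congr rfl fun k _ => ?_
    dsimp only
    split_ifs with hk
    · simp only [hk, true_and]
      rw [← sum_filter, oddSigmaSeries, coeff_mk, one_mul, mul_sum, mul_sum]
      refine sum_congr ?_ fun _ _ => rfl
      ext d
      simp only [mem_filter, mem_range, Nat.mem_divisors]
      refine ⟨fun h => ⟨?_, h⟩, fun h => h.2⟩
      have := Nat.le_of_dvd (by omega) h.1
      omega
    · simp [hk]
  have h2 : ∑ t ∈ antidiagonal n ×ˢ range (n + 1) ×ˢ range (2 * n + 2) with
        t.2.1 * (t.2.1 + 1) / 2 = t.1.1 ∧ t.2.2 ∈ (2 * t.1.2 + 1).divisors,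
        2 * (((t.1.2 : ℤ) - 4 * t.1.1) * t.2.2) =
      ∑ t ∈ discTriples (8 * n + 5) with 0 < t.1, t.2.1 * (t.2.1 * t.2.2 - t.1 ^ 2) := by
    refine sum_bij (fun t _ => ((2 * t.2.1 + 1 : ℤ), (t.2.2 : ℤ), (((2 * t.1.2 + 1) / t.2.2 : ℕ) : ℤ)))
      ?_ ?_ ?_ ?_
    · rintro ⟨⟨a, b⟩, k, d⟩ h
      simp only [mem_filter, mem_product, HasAntidiagonal.mem_antidiagonal, mem_range, Nat.mem_divisors,
        mem_discTriples] at h ⊢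
      obtain ⟨⟨hab, hk, hd⟩, hka, ⟨e, he⟩, -⟩ := h
      have hd0 : 0 < d := by
        rcases Nat.eq_zero_or_pos d with rfl | h
        · simp at he
        · exact h
      have he0 : 0 < e := by
        rcases Nat.eq_zero_or_pos e with rfl | h
        · simp at he
        · exact h
      rw [he, Nat.mul_div_cancel_left _ hd0]
      have := two_mul_triangle k
      rw [hka] at this
      zify at this he hab hd0 he0
      refine ⟨⟨hd0, he0, ?_⟩, by positivity⟩
      linear_combination (-4) * he - 4 * this + 8 * hab
    · rintro ⟨⟨a, b⟩, k, d⟩ h ⟨⟨a', b'⟩, k', d'⟩ h' heq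
      simp only [mem_filter, mem_product, HasAntidiagonal.mem_antidiagonal, Prod.mk.injEq] at h h' heq ⊢
      obtain rfl : k = k' := by omega
      omega
    · rintro ⟨u, d, e⟩ h
      simp only [mem_filter, mem_discTriples] at h
      obtain ⟨⟨hd, he, h⟩, hu⟩ := h
      lift d to ℕ using hd.le
      lift e to ℕ using he.le
      obtain ⟨k, rfl⟩ : Odd u := by
        by_contra hu
        obtain ⟨r, rfl⟩ := Int.not_odd_iff_even.1 hu
        ring_nf at h
        omega
      lift k to ℕ using by omega
      have hk := two_mul_triangle k
      have hkk := le_triangle k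
      obtain ⟨a, ha⟩ : ∃ a, a = k * (k + 1) / 2 := ⟨_, rfl⟩
      rw [← ha] at hk hkk
      zify at hk
      have h' : (8 * a + 4 * (d * e) : ℤ) = 8 * n + 4 := by
        linear_combination h + 4 * hk
      norm_cast at h'
      have hde : 2 * (n - a) + 1 = d * e := by omega
      refine ⟨⟨⟨a, n - a⟩, k, d⟩, ?_, ?_⟩
      · simp only [mem_filter, mem_product, HasAntidiagonal.mem_antidiagonal, mem_range, Nat.mem_divisors]
        have : d ≤ d * e := Nat.le_mul_of_pos_right _ (by omega)
        refine ⟨⟨?_, ?_, ?_⟩, ha.symm, ⟨e, hde⟩, by omega⟩ <;> omega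
      · simp only [hde]
        rw [Nat.mul_div_cancel_left _ (by omega)]
    · rintro ⟨⟨a, b⟩, k, d⟩ h
      simp only [mem_filter, mem_product, HasAntidiagonal.mem_antidiagonal, mem_range, Nat.mem_divisors] at h ⊢
      obtain ⟨⟨hab, hk, hd⟩, hka, ⟨e, he⟩, -⟩ := h
      have hd0 : 0 < d := by
        rcases Nat.eq_zero_or_pos d with rfl | h
        · simp at he
        · exact h
      rw [he, Nat.mul_div_cancel_left _ hd0]
      have := two_mul_triangle k
      rw [hka] at this
      zify at this he
      linear_combination d * he - 4 * d * this
  omega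

theorem constantCoeff_triangleSeries : constantCoeff triangleSeries = 1 := by
  rw [← coeff_zero_eq_constantCoeff_apply, triangleSeries, coeff_mk]
  decide

theorem constantCoeff_oddSigmaSeries : constantCoeff oddSigmaSeries = 1 := by
  rw [← coeff_zero_eq_constantCoeff_apply, oddSigmaSeries, coeff_mk]
  decide

theorem triangleSeries_mul_derivative :
    triangleSeries * derivative ℤ oddSigmaSeries =
      4 * (derivative ℤ triangleSeries * oddSigmaSeries) := by
  have hX (f : ℤ⟦X⟧) (n : ℕ) : coeff n (X * derivative ℤ f) = n * coeff n f := by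
    rcases n with _ | n
    · simp
    · rw [coeff_succ_X_mul, coeff_derivative]
      push_cast
      ring
  refine mul_left_cancel₀ (X_ne_zero (R := ℤ)) (sub_eq_zero.1 ?_)
  ext n
  rw [show X * (triangleSeries * derivative ℤ oddSigmaSeries) -
      X * (4 * (derivative ℤ triangleSeries * oddSigmaSeries)) =
      triangleSeries * (X * derivative ℤ oddSigmaSeries) -
      (4 : ℤ) • ((X * derivative ℤ triangleSeries) * oddSigmaSeries) by
    rw [zsmul_eq_mul]; push_cast; ring, map_sub, map_zsmul, coeff_mul, coeff_mul, smul_sum,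
    ← sum_sub_distrib, map_zero, ← sum_antidiagonal_triangle_oddSigma n]
  refine sum_congr rfl fun p _ => ?_
  rw [hX, hX, smul_eq_mul]
  ring

/-- The fourth power of the generating function of the triangular numbers. -/
theorem triangleSeries_pow_four : triangleSeries ^ 4 = oddSigmaSeries := by
  have hu : IsUnit triangleSeries := by
    rw [isUnit_iff_constantCoeff, constantCoeff_triangleSeries]
    exact isUnit_one
  obtain ⟨ψ, hψ⟩ := hu
  have h1 : triangleSeries * (↑ψ⁻¹ : ℤ⟦X⟧) = 1 := by rw [← hψ, Units.mul_inv]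
  have h : oddSigmaSeries * (↑ψ⁻¹ : ℤ⟦X⟧) ^ 4 = 1 := by
    refine derivative.ext (R := ℤ) ?_ ?_
    · rw [derivative_one, Derivation.leibniz, derivative_pow, derivative_inv, hψ]
      simp only [smul_eq_mul]
      push_cast
      linear_combination (↑ψ⁻¹ : ℤ⟦X⟧) ^ 5 * triangleSeries_mul_derivative -
        (↑ψ⁻¹ : ℤ⟦X⟧) ^ 4 * derivative ℤ oddSigmaSeries * h1
    · have := congrArg constantCoeff h1
      rw [map_mul, constantCoeff_triangleSeries, one_mul, map_one] at this
      rw [map_mul, map_pow, this, constantCoeff_oddSigmaSeries]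
      simp
  calc triangleSeries ^ 4 = triangleSeries ^ 4 * (oddSigmaSeries * (↑ψ⁻¹ : ℤ⟦X⟧) ^ 4) := by
        rw [h, mul_one]
    _ = (triangleSeries * (↑ψ⁻¹ : ℤ⟦X⟧)) ^ 4 * oddSigmaSeries := by ring
    _ = oddSigmaSeries := by rw [h1, one_pow, one_mul]

/-- The quadruples `(k, l, k', l')` of positive integers with `k * l + k' * l' = n`. -/
noncomputable def posQuads (n : ℤ) : Finset (ℤ × ℤ × ℤ × ℤ) :=
  {t ∈ Icc 1 n ×ˢ Icc 1 n ×ˢ Icc 1 n ×ˢ Icc 1 n | t.1 * t.2.1 + t.2.2.1 * t.2.2.2 = n}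

theorem mem_posQuads {n k l k' l' : ℤ} : (k, l, k', l') ∈ posQuads n ↔
    0 < k ∧ 0 < l ∧ 0 < k' ∧ 0 < l' ∧ k * l + k' * l' = n := by
  simp only [posQuads, mem_filter, mem_product, mem_Icc]
  refine ⟨fun h => ⟨by omega, by omega, by omega, by omega, h.2⟩,
    fun ⟨hk, hl, hk', hl', h⟩ => ⟨⟨?_, ?_, ?_, ?_⟩, h⟩⟩ <;>
  constructor <;> nlinarith [mul_pos hk hl, mul_pos hk' hl']

section ResidueCounts

variable {N : ℕ} (a b : ZMod N) (n : ℤ)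

/-- The quadruples with odd `l`, `l'` whose `(k, k')` reduces to `±(a, b)`. -/
noncomputable def sameSignQuads : Finset (ℤ × ℤ × ℤ × ℤ) :=
  {t ∈ posQuads n | Odd t.2.1 ∧ Odd t.2.2.2 ∧
    (((t.1 : ZMod N) = a ∧ (t.2.2.1 : ZMod N) = b) ∨
      ((t.1 : ZMod N) = -a ∧ (t.2.2.1 : ZMod N) = -b))}

/-- The quadruples with even second entry, odd fourth entry, first entry reducing to `±a` and third
entry reducing to `c`. -/
noncomputable def evenOddQuads (c : ZMod N) : Finset (ℤ × ℤ × ℤ × ℤ) :=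
  {t ∈ posQuads n | Even t.2.1 ∧ Odd t.2.2.2 ∧ (t.2.2.1 : ZMod N) = c ∧
    ((t.1 : ZMod N) = a ∨ (t.1 : ZMod N) = -a)}

variable {a b}

theorem card_sameSignQuads_swap :
    #{t ∈ sameSignQuads a b n | t.2.1 < t.2.2.2} = #{t ∈ sameSignQuads b a n | t.2.2.2 < t.2.1} := by
  refine card_nbij' (fun t => (t.2.2.1, t.2.2.2, t.1, t.2.1))
    (fun t => (t.2.2.1, t.2.2.2, t.1, t.2.1)) ?_ ?_ ?_ ?_
  · rintro ⟨k, l, k', l'⟩ h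
    simp only [sameSignQuads, coe_filter, Set.mem_ofPred_eq, mem_filter, mem_posQuads] at h ⊢
    refine ⟨⟨⟨?_, ?_, ?_, ?_, ?_⟩, ?_⟩, ?_⟩ <;> first | tauto | linarith
  · rintro ⟨k, l, k', l'⟩ h
    simp only [sameSignQuads, coe_filter, Set.mem_ofPred_eq, mem_filter, mem_posQuads] at h ⊢
    refine ⟨⟨⟨?_, ?_, ?_, ?_, ?_⟩, ?_⟩, ?_⟩ <;> first | tauto | linarith
  · intro _ _; rfl
  · intro _ _; rfl

theorem card_oppSignQuads_swap :
    #{t ∈ sameSignQuads a (-b) n | t.1 < t.2.2.1} = #{t ∈ sameSignQuads b (-a) n | t.2.2.1 < t.1} := by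
  refine card_nbij' (fun t => (t.2.2.1, t.2.2.2, t.1, t.2.1))
    (fun t => (t.2.2.1, t.2.2.2, t.1, t.2.1)) ?_ ?_ ?_ ?_
  · rintro ⟨k, l, k', l'⟩ h
    simp only [sameSignQuads, coe_filter, Set.mem_ofPred_eq, mem_filter, mem_posQuads,
      neg_neg] at h ⊢
    refine ⟨⟨⟨?_, ?_, ?_, ?_, ?_⟩, ?_⟩, ?_⟩ <;> first | tauto | linarith
  · rintro ⟨k, l, k', l'⟩ h
    simp only [sameSignQuads, coe_filter, Set.mem_ofPred_eq, mem_filter, mem_posQuads,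
      neg_neg] at h ⊢
    refine ⟨⟨⟨?_, ?_, ?_, ?_, ?_⟩, ?_⟩, ?_⟩ <;> first | tauto | linarith
  · intro _ _; rfl
  · intro _ _; rfl

theorem card_sameSignQuads_filter_lt (hab : a + b + (a + b) = 0) :
    #{t ∈ sameSignQuads a b n | t.2.2.2 < t.2.1} =
      #{t ∈ evenOddQuads a n (a + b) | t.1 < t.2.2.1} := by
  refine card_nbij' (fun t => (t.1, t.2.1 - t.2.2.2, t.1 + t.2.2.1, t.2.2.2))
    (fun t => (t.1, t.2.1 + t.2.2.2, t.2.2.1 - t.1, t.2.2.2)) ?_ ?_ ?_ ?_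
  · rintro ⟨k, l, k', l'⟩ h
    simp only [sameSignQuads, evenOddQuads, coe_filter, Set.mem_ofPred_eq, mem_filter,
      mem_posQuads] at h ⊢
    obtain ⟨⟨⟨hk, hl, hk', hl', h⟩, ho, ho', hr⟩, hlt⟩ := h
    refine ⟨⟨⟨hk, by omega, by omega, hl', by linear_combination h⟩, ho.sub_odd ho', ho', ?_⟩,
      by omega⟩
    push_cast
    rcases hr with ⟨h1, h2⟩ | ⟨h1, h2⟩ <;> rw [h1, h2]
    · simp
    · exact ⟨by linear_combination -hab, Or.inr rfl⟩
  · rintro ⟨k, l, k', l'⟩ h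
    simp only [sameSignQuads, evenOddQuads, coe_filter, Set.mem_ofPred_eq, mem_filter,
      mem_posQuads] at h ⊢
    obtain ⟨⟨⟨hk, hl, hk', hl', h⟩, ho, ho', hp, hr⟩, hlt⟩ := h
    refine ⟨⟨⟨hk, by omega, by omega, hl', by linear_combination h⟩, ho.add_odd ho', ho', ?_⟩,
      by omega⟩
    push_cast
    rcases hr with h1 | h1 <;> rw [h1, hp]
    · exact Or.inl ⟨rfl, by ring⟩
    · exact Or.inr ⟨rfl, by linear_combination hab⟩
  · rintro ⟨k, l, k', l'⟩ h
    simp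
  · rintro ⟨k, l, k', l'⟩ h
    simp

theorem card_oppSignQuads_filter_lt (hab : a + b + (a + b) = 0) :
    #{t ∈ sameSignQuads a (-b) n | t.2.2.1 < t.1} =
      #{t ∈ evenOddQuads b n (a + b) | t.2.2.2 < t.2.1} := by
  refine card_nbij' (fun t => (t.2.2.1, t.2.1 + t.2.2.2, t.1 - t.2.2.1, t.2.1))
    (fun t => (t.1 + t.2.2.1, t.2.2.2, t.1, t.2.1 - t.2.2.2)) ?_ ?_ ?_ ?_
  · rintro ⟨k, l, k', l'⟩ h
    simp only [sameSignQuads, evenOddQuads, coe_filter, Set.mem_ofPred_eq, mem_filter,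
      mem_posQuads] at h ⊢
    obtain ⟨⟨⟨hk, hl, hk', hl', h⟩, ho, ho', hr⟩, hlt⟩ := h
    refine ⟨⟨⟨hk', by omega, by omega, hl, by linear_combination h⟩, ho.add_odd ho', ho, ?_⟩,
      by omega⟩
    push_cast
    rcases hr with ⟨h1, h2⟩ | ⟨h1, h2⟩ <;> rw [h1, h2]
    · simp
    · exact ⟨by linear_combination -hab, Or.inl (neg_neg b)⟩
  · rintro ⟨k, l, k', l'⟩ h
    simp only [sameSignQuads, evenOddQuads, coe_filter, Set.mem_ofPred_eq, mem_filter,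
      mem_posQuads] at h ⊢
    obtain ⟨⟨⟨hk, hl, hk', hl', h⟩, ho, ho', hp, hr⟩, hlt⟩ := h
    refine ⟨⟨⟨by omega, hl', hk, by omega, by linear_combination h⟩, ho', ho.sub_odd ho', ?_⟩,
      by omega⟩
    push_cast
    rcases hr with h1 | h1 <;> rw [h1, hp]
    · exact Or.inr ⟨by linear_combination hab, (neg_neg b).symm⟩
    · exact Or.inl ⟨by ring, rfl⟩
  · rintro ⟨k, l, k', l'⟩ h
    simp
  · rintro ⟨k, l, k', l'⟩ h
    simp

theorem card_evenOddQuads_filter_lt (hab : a + b + (a + b) = 0) :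
    #{t ∈ evenOddQuads a n (a + b) | t.2.1 < t.2.2.2} =
      #{t ∈ evenOddQuads b n (a + b) | t.2.2.1 < t.1} := by
  refine card_nbij' (fun t => (t.1 + t.2.2.1, t.2.1, t.2.2.1, t.2.2.2 - t.2.1))
    (fun t => (t.1 - t.2.2.1, t.2.1, t.2.2.1, t.2.2.2 + t.2.1)) ?_ ?_ ?_ ?_
  · rintro ⟨k, l, k', l'⟩ h
    simp only [evenOddQuads, coe_filter, Set.mem_ofPred_eq, mem_filter, mem_posQuads] at h ⊢
    obtain ⟨⟨⟨hk, hl, hk', hl', h⟩, ho, ho', hp, hr⟩, hlt⟩ := h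
    refine ⟨⟨⟨by omega, hl, hk', by omega, by linear_combination h⟩, ho, ho'.sub_even ho, hp, ?_⟩,
      by omega⟩
    push_cast
    rcases hr with h1 | h1 <;> rw [h1, hp]
    · exact Or.inr (by linear_combination hab)
    · exact Or.inl (by ring)
  · rintro ⟨k, l, k', l'⟩ h
    simp only [evenOddQuads, coe_filter, Set.mem_ofPred_eq, mem_filter, mem_posQuads] at h ⊢
    obtain ⟨⟨⟨hk, hl, hk', hl', h⟩, ho, ho', hp, hr⟩, hlt⟩ := h
    refine ⟨⟨⟨by omega, hl, hk', by omega, by linear_combination h⟩, ho, ho'.add_even ho, hp, ?_⟩,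
      by omega⟩
    push_cast
    rcases hr with h1 | h1 <;> rw [h1, hp]
    · exact Or.inr (by ring)
    · exact Or.inl (by linear_combination -hab)
  · rintro ⟨k, l, k', l'⟩ h
    simp
  · rintro ⟨k, l, k', l'⟩ h
    simp

theorem card_filter_lt_add_gt {α : Type*} (s : Finset α) (f g : α → ℤ)
    (h : ∀ t ∈ s, f t ≠ g t) : #{t ∈ s | f t < g t} + #{t ∈ s | g t < f t} = #s := by
  rw [← card_filter_add_card_filter_not (s := s) (fun t => f t < g t)]
  congr 2
  refine filter_congr fun t ht => ?_
  have := h t ht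
  omega

theorem card_sameSignQuads (hab : a + b + (a + b) = 0) (ha : a ≠ 0) (hb : b ≠ 0)
    (hc : a + b ≠ 0) : #(sameSignQuads a b n) =
      #{t ∈ sameSignQuads a b n | t.2.1 = t.2.2.2} + #(sameSignQuads a (-b) n) := by
  have hba : b + a + (b + a) = 0 := by rw [add_comm b a, hab]
  have hsplit : #{t ∈ sameSignQuads a b n | ¬ t.2.1 = t.2.2.2} =
      #{t ∈ sameSignQuads a b n | t.2.2.2 < t.2.1} +
        #{t ∈ sameSignQuads a b n | t.2.1 < t.2.2.2} := by
    rw [← card_filter_lt_add_gt _ (fun t => t.2.2.2) (fun t => t.2.1), filter_filter,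
      filter_filter]
    · congr 2 <;> exact filter_congr fun t _ => by omega
    · intro t ht
      simpa [eq_comm] using (mem_filter.1 ht).2
  have hopp : #{t ∈ sameSignQuads a (-b) n | t.1 < t.2.2.1} +
      #{t ∈ sameSignQuads a (-b) n | t.2.2.1 < t.1} = #(sameSignQuads a (-b) n) := by
    refine card_filter_lt_add_gt (sameSignQuads a (-b) n) (fun t => t.1) (fun t => t.2.2.1)
      fun t ht h => hc ?_
    simp only [sameSignQuads, mem_filter, h] at ht
    rcases ht.2.2.2 with ⟨h1, h2⟩ | ⟨h1, h2⟩
    · linear_combination h2 - h1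
    · linear_combination h1 - h2
  have hk (x y : ZMod N) (hxy : x + y + (x + y) = 0) (hy : y ≠ 0) :
      #{t ∈ evenOddQuads x n (x + y) | t.1 < t.2.2.1} +
        #{t ∈ evenOddQuads x n (x + y) | t.2.2.1 < t.1} = #(evenOddQuads x n (x + y)) := by
    refine card_filter_lt_add_gt (evenOddQuads x n (x + y)) (fun t => t.1) (fun t => t.2.2.1)
      fun t ht h => ?_
    simp only [evenOddQuads, mem_filter, h] at ht
    obtain ⟨-, -, -, h0, h1 | h1⟩ := ht
    · exact hy (by linear_combination h1 - h0)
    · exact hy (by linear_combination hxy + h0 - h1)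
  have hl (x y : ZMod N) : #{t ∈ evenOddQuads x n y | t.2.2.2 < t.2.1} +
        #{t ∈ evenOddQuads x n y | t.2.1 < t.2.2.2} = #(evenOddQuads x n y) := by
    refine card_filter_lt_add_gt (evenOddQuads x n y) (fun t => t.2.2.2) (fun t => t.2.1)
      fun t ht h => ?_
    simp only [evenOddQuads, mem_filter, h] at ht
    exact Int.not_even_iff_odd.2 (h ▸ ht.2.2.1) ht.2.1
  have h1 := card_sameSignQuads_filter_lt n hab
  have h2 := card_sameSignQuads_filter_lt n hba
  have h3 := card_oppSignQuads_filter_lt n hab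
  have h4 := card_oppSignQuads_filter_lt n hba
  have h5 := card_evenOddQuads_filter_lt n hab
  have h6 := card_evenOddQuads_filter_lt n hba
  have h7 := card_sameSignQuads_swap (a := a) (b := b) n
  have h8 := card_oppSignQuads_swap (a := a) (b := b) n
  have h9 := hk a b hab hb
  have h10 := hk b a hba ha
  have h11 := hl a (a + b)
  have h12 := hl b (a + b)
  rw [add_comm b a] at h2 h4 h6 h10
  rw [← card_filter_add_card_filter_not (s := sameSignQuads a b n) (fun t => t.2.1 = t.2.2.2)]
  omega

end ResidueCounts

theorem card_Ioo_filter_zmod {i j : ℕ} (hi : 0 < i) (hj : 0 < j) (r : ℕ) :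
    #{k ∈ Ioo (0 : ℤ) ((i + j : ℕ) * (2 * r + 1)) | ((k : ℤ) : ZMod (2 * (i + j))) = (i : ℕ) ∨
      ((k : ℤ) : ZMod (2 * (i + j))) = -(i : ℕ)} = 2 * r + 1 := by
  have hcount (v : ℤ) (s : ℕ) (hv : ⌊(((i + j : ℕ) * (2 * r + 1) - 1 : ℤ) - v : ℚ) /
      ((2 * (i + j) : ℕ) : ℤ)⌋ - ⌊((0 : ℤ) - v : ℚ) / ((2 * (i + j) : ℕ) : ℤ)⌋ = s) :
      #{k ∈ Ioo (0 : ℤ) ((i + j : ℕ) * (2 * r + 1)) | ((k : ℤ) : ZMod (2 * (i + j))) = (v : ℤ)} = s := by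
    have h := Int.Ioc_filter_modEq_card 0 ((i + j : ℕ) * (2 * r + 1) - 1)
      (r := ((2 * (i + j) : ℕ) : ℤ)) (by positivity) v
    rw [hv, max_eq_left (by positivity)] at h
    rw [← Nat.cast_inj (R := ℤ), ← h]
    congr 2
    ext k
    rw [mem_filter, mem_filter, ZMod.intCast_eq_intCast_iff, mem_Ioo, mem_Ioc]
    have : (k < (i + j : ℕ) * (2 * r + 1)) ↔ k ≤ ((i + j : ℕ) * (2 * r + 1) - 1 : ℤ) := by omega
    rw [this]
  have hpos : (0 : ℚ) < 2 * (i + j) := by positivity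
  have hi' : (1 : ℚ) ≤ i := by exact_mod_cast hi
  have hj' : (1 : ℚ) ≤ j := by exact_mod_cast hj
  have h1 := hcount i (r + 1) (by
    rw [show ⌊(((i + j : ℕ) * (2 * r + 1) - 1 : ℤ) - (i : ℤ) : ℚ) /
      ((2 * (i + j) : ℕ) : ℤ)⌋ = r from ?_, show ⌊((0 : ℤ) - (i : ℤ) : ℚ) /
      ((2 * (i + j) : ℕ) : ℤ)⌋ = -1 from ?_]
    · push_cast; ring
    · rw [Int.floor_eq_iff]
      push_cast
      rw [le_div_iff₀ hpos, div_lt_iff₀ hpos]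
      constructor <;> nlinarith
    · rw [Int.floor_eq_iff]
      push_cast
      rw [le_div_iff₀ hpos, div_lt_iff₀ hpos]
      constructor <;> nlinarith)
  have h2 := hcount (-i) r (by
    rw [show ⌊(((i + j : ℕ) * (2 * r + 1) - 1 : ℤ) - (-i : ℤ) : ℚ) /
      ((2 * (i + j) : ℕ) : ℤ)⌋ = r from ?_, show ⌊((0 : ℤ) - (-i : ℤ) : ℚ) /
      ((2 * (i + j) : ℕ) : ℤ)⌋ = 0 from ?_]
    · ring
    · rw [Int.floor_eq_iff]
      push_cast
      rw [le_div_iff₀ hpos, div_lt_iff₀ hpos]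
      constructor <;> nlinarith
    · rw [Int.floor_eq_iff]
      push_cast
      rw [le_div_iff₀ hpos, div_lt_iff₀ hpos]
      constructor <;> nlinarith)
  push_cast at h1 h2 ⊢
  rw [filter_or, card_union_of_disjoint, h1, h2]
  · ring
  · rw [disjoint_filter]
    intro k _ hk hk'
    rw [hk, ← sub_eq_zero, sub_neg_eq_add] at hk'
    have h0 : ((i + i : ℕ) : ZMod (2 * (i + j))) = 0 := by exact_mod_cast hk'
    rw [ZMod.natCast_eq_zero_iff] at h0
    have := Nat.le_of_dvd (by omega) h0
    omega

/-- The odd function on `ZMod N` supported on `±c` with value `1` at `c`. -/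
def resSign {N : ℕ} (c k : ZMod N) : ℤ := if k = c then 1 else if k = -c then -1 else 0

/-- The generating function of the pairs `(k, l)` with `k ≡ ±c` and `l` odd, weighted by the
sign of the residue of `k`. -/
noncomputable def lambertSeries {N : ℕ} (c : ZMod N) : ℤ⟦X⟧ :=
  PowerSeries.mk fun d => ∑ p ∈ d.divisorsAntidiagonal with Odd p.2, resSign c (p.1 : ZMod N)

/-- The pairs `(k, l)` of positive integers at most `n` with `l` odd. -/
def oddPairs (n : ℕ) : Finset (ℕ × ℕ) := {p ∈ Icc 1 n ×ˢ Icc 1 n | Odd p.2}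

theorem coeff_lambertSeries {N : ℕ} (c : ZMod N) {d n : ℕ} (h : d ≤ n) :
    coeff d (lambertSeries c) =
      coeff d (∑ p ∈ oddPairs n, monomial (p.1 * p.2) (resSign c (p.1 : ZMod N))) := by
  simp_rw [map_sum, coeff_monomial, lambertSeries, coeff_mk]
  rw [← sum_filter]
  refine sum_congr ?_ fun _ _ => rfl
  ext ⟨k, l⟩
  simp only [oddPairs, mem_filter, Nat.mem_divisorsAntidiagonal, mem_product, mem_Icc]
  constructor
  · rintro ⟨⟨rfl, h0⟩, hl⟩
    have hk : 0 < k := Nat.pos_of_ne_zero (by rintro rfl; simp at h0)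
    have hl' : 0 < l := hl.pos
    have := Nat.le_mul_of_pos_right k hl'
    have := Nat.le_mul_of_pos_left l hk
    exact ⟨⟨⟨⟨hk, by omega⟩, hl', by omega⟩, hl⟩, rfl⟩
  · rintro ⟨⟨⟨⟨hk, -⟩, hl', -⟩, hl⟩, rfl⟩
    exact ⟨⟨rfl, (Nat.mul_pos hk hl').ne'⟩, hl⟩

theorem coeff_lambertSeries_mul {N : ℕ} (a b : ZMod N) (n : ℕ) :
    coeff n (lambertSeries a * lambertSeries b) =
      ∑ t ∈ posQuads n with Odd t.2.1 ∧ Odd t.2.2.2,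
        resSign a (t.1 : ZMod N) * resSign b (t.2.2.1 : ZMod N) := by
  have h : coeff n (lambertSeries a * lambertSeries b) =
      coeff n ((∑ p ∈ oddPairs n, monomial (p.1 * p.2) (resSign a (p.1 : ZMod N))) *
        ∑ p ∈ oddPairs n, monomial (p.1 * p.2) (resSign b (p.1 : ZMod N))) := by
    rw [coeff_mul, coeff_mul]
    refine sum_congr rfl fun p hp => ?_
    rw [HasAntidiagonal.mem_antidiagonal] at hp
    rw [coeff_lambertSeries a (show p.1 ≤ n by omega),
      coeff_lambertSeries b (show p.2 ≤ n by omega)]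
  rw [h, sum_mul_sum, ← sum_product', map_sum]
  simp_rw [monomial_mul_monomial, coeff_monomial]
  rw [← sum_filter]
  refine sum_nbij' (fun t => ((t.1.1 : ℤ), (t.1.2 : ℤ), (t.2.1 : ℤ), (t.2.2 : ℤ)))
    (fun t => ((t.1.toNat, t.2.1.toNat), (t.2.2.1.toNat, t.2.2.2.toNat))) ?_ ?_ ?_ ?_ ?_
  · rintro ⟨⟨k, l⟩, k', l'⟩ ht
    simp only [oddPairs, mem_filter, mem_product, mem_Icc, mem_posQuads] at ht ⊢
    obtain ⟨⟨⟨⟨⟨hk, -⟩, hl, -⟩, ho⟩, ⟨⟨hk', -⟩, hl', -⟩, ho'⟩, h⟩ := ht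
    exact ⟨⟨by omega, by omega, by omega, by omega, by rw [h]; push_cast; rfl⟩,
      by exact_mod_cast ho, by exact_mod_cast ho'⟩
  · rintro ⟨k, l, k', l'⟩ ht
    simp only [mem_filter, mem_posQuads] at ht
    obtain ⟨⟨hk, hl, hk', hl', h⟩, ho, ho'⟩ := ht
    lift k to ℕ using hk.le
    lift l to ℕ using hl.le
    lift k' to ℕ using hk'.le
    lift l' to ℕ using hl'.le
    norm_cast at hk hl hk' hl' h ho ho'
    have h1 := Nat.le_mul_of_pos_right k hl
    have h2 := Nat.le_mul_of_pos_left l hk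
    have h3 := Nat.le_mul_of_pos_right k' hl'
    have h4 := Nat.le_mul_of_pos_left l' hk'
    simp only [oddPairs, mem_filter, mem_product, mem_Icc, Int.toNat_natCast]
    exact ⟨⟨⟨⟨⟨hk, by omega⟩, hl, by omega⟩, ho⟩, ⟨⟨hk', by omega⟩, hl', by omega⟩, ho'⟩, h.symm⟩
  · simp
  · rintro ⟨k, l, k', l'⟩ ht
    simp only [mem_filter, mem_posQuads] at ht
    obtain ⟨⟨hk, hl, hk', hl', h⟩, ho, ho'⟩ := ht
    simp [hk.le, hl.le, hk'.le, hl'.le]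
  · simp

theorem coeff_lambertSeries_mul_eq_card_sub {N : ℕ} {a b : ZMod N} (ha : a ≠ -a) (hb : b ≠ -b)
    (n : ℕ) : coeff n (lambertSeries a * lambertSeries b) =
      #(sameSignQuads a b n) - #(sameSignQuads a (-b) n) := by
  rw [coeff_lambertSeries_mul, sum_filter, sameSignQuads, sameSignQuads, card_filter, card_filter]
  push_cast
  rw [← sum_sub_distrib]
  refine sum_congr rfl fun t _ => ?_
  by_cases h1 : Odd t.2.1 <;> by_cases h2 : Odd t.2.2.2 <;> simp only [h1, h2, true_and, and_true,
    false_and, and_false, if_true, if_false, sub_self, neg_neg]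
  generalize (t.1 : ZMod N) = x
  generalize (t.2.2.1 : ZMod N) = y
  simp only [resSign]
  by_cases hx : x = a
  · by_cases hy : y = b
    · simp [hx, hy, ha, hb]
    · by_cases hy' : y = -b
      · simp [hx, hy', ha, hb.symm]
      · simp [hx, hy, hy']
  · by_cases hx' : x = -a
    · by_cases hy : y = b
      · simp [hx', hy, ha.symm, hb]
      · by_cases hy' : y = -b
        · simp [hx', hy', ha.symm, hb.symm]
        · simp [hx', hy, hy']
    · simp [hx, hx']

theorem card_sameSignQuads_diag {i j : ℕ} (hi : 0 < i) (hj : 0 < j) (n : ℕ) :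
    #{t ∈ sameSignQuads (i : ZMod (2 * (i + j))) (j : ZMod (2 * (i + j))) n | t.2.1 = t.2.2.2} =
      ∑ d ∈ n.divisors with Odd (n / d) ∧ d % (2 * (i + j)) = i + j, d / (i + j) := by
  have hM : 0 < i + j := by omega
  have hdouble : ((i : ZMod (2 * (i + j))) + j) + (i + j) = 0 := by
    have := ZMod.natCast_self (2 * (i + j))
    push_cast at this
    linear_combination this
  have hmod (d : ℕ) : (d : ZMod (2 * (i + j))) = i + j ↔ d % (2 * (i + j)) = i + j := by
    rw [← Nat.cast_add, ZMod.natCast_eq_natCast_iff, Nat.ModEq, Nat.mod_eq_of_lt (a := i + j)]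
    omega
  have hcard : ∑ d ∈ n.divisors with Odd (n / d) ∧ d % (2 * (i + j)) = i + j, d / (i + j) =
      ∑ d ∈ n.divisors with Odd (n / d) ∧ d % (2 * (i + j)) = i + j,
        #{k ∈ Ioo (0 : ℤ) d | ((k : ℤ) : ZMod (2 * (i + j))) = (i : ℕ) ∨
          ((k : ℤ) : ZMod (2 * (i + j))) = -(i : ℕ)} := by
    refine sum_congr rfl fun d hd => ?_
    have hd' := (mem_filter.1 hd).2.2
    obtain ⟨r, rfl⟩ : ∃ r, d = (i + j) * (2 * r + 1) := by
      refine ⟨d / (2 * (i + j)), ?_⟩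
      have := Nat.div_add_mod d (2 * (i + j))
      rw [hd'] at this
      linarith
    rw [Nat.mul_div_cancel_left _ hM]
    refine (card_Ioo_filter_zmod hi hj r).symm.trans ?_
    push_cast
    rfl
  rw [hcard, ← card_sigma]
  refine card_nbij' (fun t => (⟨(t.1 + t.2.2.1).toNat, t.1⟩ : (_ : ℕ) × ℤ))
    (fun t => (t.2, ((n / t.1 : ℕ) : ℤ), t.1 - t.2, ((n / t.1 : ℕ) : ℤ))) ?_ ?_ ?_ ?_
  · rintro ⟨k, l, k', l'⟩ h
    simp only [sameSignQuads, coe_filter, Set.mem_ofPred_eq, mem_filter, mem_posQuads] at h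
    obtain ⟨⟨⟨hk, hl, hk', hl', h⟩, ho, ho', hr⟩, rfl⟩ := h
    obtain ⟨d, hd⟩ := Int.eq_ofNat_of_zero_le (show 0 ≤ k + k' by omega)
    lift l to ℕ using hl.le
    have hn : d * l = n := by
      zify
      rw [← hd]
      linear_combination h
    have hd0 : 0 < d := by omega
    norm_cast at hl ho
    simp only [coe_sigma, Set.mem_sigma_iff, SetLike.mem_coe, mem_filter, Nat.mem_divisors, hd,
      Int.toNat_natCast, mem_Ioo]
    refine ⟨⟨⟨⟨l, hn.symm⟩, ?_⟩, ?_, ?_⟩, ⟨hk, by omega⟩, ?_⟩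
    · rw [← hn]; positivity
    · rwa [← hn, Nat.mul_div_cancel_left _ hd0]
    · have hdc : (d : ZMod (2 * (i + j))) = (k : ZMod (2 * (i + j))) + k' := by
        have := congrArg (Int.cast : ℤ → ZMod (2 * (i + j))) hd
        push_cast at this
        exact this.symm
      rw [← hmod, hdc]
      rcases hr with ⟨h1, h2⟩ | ⟨h1, h2⟩ <;> rw [h1, h2]
      linear_combination -hdouble
    · rcases hr with ⟨h1, h2⟩ | ⟨h1, h2⟩
      · exact Or.inl h1
      · exact Or.inr h1
  · rintro ⟨d, k⟩ h
    simp only [coe_sigma, Set.mem_sigma_iff, SetLike.mem_coe, mem_filter, Nat.mem_divisors,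
      mem_Ioo] at h
    obtain ⟨⟨⟨⟨l, rfl⟩, hn0⟩, ho, hd⟩, ⟨hk, hkd⟩, hr⟩ := h
    have hd0 : 0 < d := by omega
    have hl0 : 0 < l := Nat.pos_of_ne_zero (by rintro rfl; simp at hn0)
    rw [Nat.mul_div_cancel_left _ hd0] at ho
    simp only [sameSignQuads, coe_filter, Set.mem_ofPred_eq, mem_filter, mem_posQuads,
      Nat.mul_div_cancel_left _ hd0]
    refine ⟨⟨⟨hk, by omega, by omega, by omega, by push_cast; ring⟩, by exact_mod_cast ho,
      by exact_mod_cast ho, ?_⟩, trivial⟩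
    push_cast
    rw [(hmod d).2 hd]
    rcases hr with h1 | h1 <;> rw [h1]
    · exact Or.inl ⟨rfl, by ring⟩
    · exact Or.inr ⟨rfl, by linear_combination hdouble⟩
  · rintro ⟨k, l, k', l'⟩ h
    simp only [sameSignQuads, coe_filter, Set.mem_ofPred_eq, mem_filter, mem_posQuads] at h
    obtain ⟨⟨⟨hk, hl, hk', hl', h⟩, ho, ho', hr⟩, rfl⟩ := h
    obtain ⟨d, hd⟩ := Int.eq_ofNat_of_zero_le (show 0 ≤ k + k' by omega)
    lift l to ℕ using hl.le
    have hn : d * l = n := by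
      zify
      rw [← hd]
      linear_combination h
    have hd0 : 0 < d := by omega
    simp only [hd, Int.toNat_natCast, ← hn, Nat.mul_div_cancel_left _ hd0]
    rw [← hd, add_sub_cancel_left]
  · rintro ⟨d, k⟩ h
    simp

theorem sum_divisors_eq_coeff {M : ℕ} (hM : 0 < M) (n : ℕ) :
    ∑ d ∈ n.divisors with Odd (n / d) ∧ d % (2 * M) = M, ((d / M : ℕ) : ℤ) =
      coeff n (X ^ M * expand (2 * M) (by omega) oddSigmaSeries) := by
  rw [coeff_X_pow_mul']
  by_cases h : ∃ s, n = M * (2 * s + 1)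
  · obtain ⟨s, rfl⟩ := h
    rw [if_pos (Nat.le_mul_of_pos_right _ (by omega)),
      show M * (2 * s + 1) - M = 2 * M * s by rw [mul_add, mul_one, Nat.add_sub_cancel]; ring,
      coeff_expand_mul, oddSigmaSeries, coeff_mk]
    symm
    refine sum_nbij' (fun e => M * e) (fun d => d / M) ?_ ?_ ?_ ?_ ?_
    · intro e he
      obtain ⟨f, hf⟩ := (Nat.mem_divisors.1 he).1
      have he0 : 0 < e := Nat.pos_of_mem_divisors he
      have hodd : Odd (e * f) := hf ▸ ⟨s, rfl⟩
      rw [Nat.odd_mul] at hodd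
      rw [mem_filter, Nat.mem_divisors, hf, ← mul_assoc, Nat.mul_div_cancel_left _ (by positivity)]
      refine ⟨⟨⟨f, rfl⟩, ?_⟩, hodd.2, ?_⟩
      · have := hodd.2.pos
        positivity
      · obtain ⟨r, rfl⟩ := hodd.1
        rw [show M * (2 * r + 1) = M + 2 * M * r by ring, Nat.add_mul_mod_self_left,
          Nat.mod_eq_of_lt (by omega)]
    · intro d hd
      rw [mem_filter, Nat.mem_divisors] at hd
      obtain ⟨⟨⟨f, hf⟩, h0⟩, -, hd⟩ := hd
      have hdM : M ∣ d := by
        rw [← Nat.dvd_mod_iff (Dvd.intro_left 2 rfl), hd]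
      obtain ⟨e, rfl⟩ := hdM
      rw [Nat.mul_div_cancel_left _ hM, Nat.mem_divisors]
      refine ⟨⟨f, ?_⟩, by omega⟩
      rw [mul_assoc] at hf
      exact Nat.eq_of_mul_eq_mul_left hM hf
    · intro e _
      exact Nat.mul_div_cancel_left _ hM
    · intro d hd
      rw [mem_filter, Nat.mem_divisors] at hd
      refine Nat.mul_div_cancel' ?_
      rw [← Nat.dvd_mod_iff (Dvd.intro_left 2 rfl), hd.2.2]
    · intro e _
      rw [Nat.mul_div_cancel_left _ hM]
  · rw [filter_false_of_mem, sum_empty]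
    · symm
      split_ifs with hMn
      · refine coeff_expand_of_not_dvd _ _ _ fun ⟨s, hs⟩ => h ⟨s, ?_⟩
        rw [← Nat.sub_add_cancel hMn, hs]
        ring
      · rfl
    · rintro d hd ⟨⟨r, hr⟩, hmod⟩
      have hn := Nat.div_mul_cancel (Nat.dvd_of_mem_divisors hd)
      have hd := Nat.div_add_mod d (2 * M)
      rw [hmod] at hd
      refine h ⟨(2 * r + 1) * (d / (2 * M)) + r, ?_⟩
      rw [← hn, hr]
      nth_rw 1 [← hd]
      ring

theorem lambertSeries_mul {i j N : ℕ} (hi : 0 < i) (hj : 0 < j) (hN : N = 2 * (i + j)) :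
    lambertSeries (i : ZMod N) * lambertSeries (j : ZMod N) =
      X ^ (i + j) * expand N (by omega) triangleSeries ^ 4 := by
  subst hN
  have hne {s : ℕ} (h0 : 0 < s) (hs : s < 2 * (i + j)) : (s : ZMod (2 * (i + j))) ≠ 0 := by
    rw [Ne, ZMod.natCast_eq_zero_iff]
    exact fun h => absurd (Nat.le_of_dvd h0 h) (by omega)
  have hneg {s : ℕ} (h0 : 0 < s) (hs : s < i + j) :
      (s : ZMod (2 * (i + j))) ≠ -(s : ZMod (2 * (i + j))) := by
    rw [Ne, ← sub_eq_zero, sub_neg_eq_add, ← Nat.cast_add]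
    exact hne (by omega) (by omega)
  have hdouble : ((i : ZMod (2 * (i + j))) + j) + (i + j) = 0 := by
    have := ZMod.natCast_self (2 * (i + j))
    push_cast at this
    linear_combination this
  ext n
  rw [← map_pow, triangleSeries_pow_four, ← sum_divisors_eq_coeff (by omega),
    coeff_lambertSeries_mul_eq_card_sub (hneg hi (by omega)) (hneg hj (by omega)),
    card_sameSignQuads n hdouble (hne hi (by omega)) (hne hj (by omega)), Nat.cast_add,
    add_sub_cancel_right, card_sameSignQuads_diag hi hj, Nat.cast_sum]
  rw [← Nat.cast_add]
  exact hne (by omega) (by omega)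

theorem coeff_prod_congr {ι : Type*} [Fintype ι] {f g : ι → ℤ⟦X⟧} {n : ℕ}
    (h : ∀ i, ∀ d ≤ n, coeff d (f i) = coeff d (g i)) :
    coeff n (∏ i, f i) = coeff n (∏ i, g i) := by
  classical
  rw [coeff_prod, coeff_prod]
  refine sum_congr rfl fun l hl => prod_congr rfl fun i _ => h i _ ?_
  rw [← (mem_finsuppAntidiag.1 hl).1]
  exact single_le_sum (fun _ _ => Nat.zero_le _) (mem_univ i)

theorem coeff_prod_sum_monomial {ι α : Type*} [Fintype ι] [DecidableEq ι] (s : Finset α)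
    (size : α → ℕ) (w : ι → α → ℤ) (n : ℕ) :
    coeff n (∏ i, ∑ a ∈ s, monomial (size a) (w i a)) =
      ∑ p ∈ Fintype.piFinset fun _ : ι => s with ∑ i, size (p i) = n, ∏ i, w i (p i) := by
  rw [prod_univ_sum, map_sum, sum_filter]
  refine sum_congr rfl fun p _ => ?_
  rw [prod_monomial, coeff_monomial]
  exact if_congr eq_comm rfl rfl

theorem coeff_triangleSeries_pow (k n : ℕ) : coeff n (triangleSeries ^ k) = triangleReps k n := by
  have h : triangleSeries ^ k = ∏ _i : Fin k, triangleSeries := by simp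
  rw [h, coeff_prod_congr (g := fun _ => ∑ a ∈ range (n + 1), monomial (a * (a + 1) / 2) 1)
    fun _ d hd => ?_, coeff_prod_sum_monomial]
  · rw [triangleReps, Nat.subtype_card
      {f ∈ Fintype.piFinset fun _ : Fin k => range (n + 1) | ∑ i, f i * (f i + 1) / 2 = n}]
    · simp
    · intro f
      rw [mem_filter, and_iff_right_iff_imp, Fintype.mem_piFinset]
      intro hf i
      have h1 := single_le_sum (f := fun i => f i * (f i + 1) / 2) (fun _ _ => Nat.zero_le _)
        (mem_univ i)
      have h2 := le_triangle (f i)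
      simp only [hf] at h1
      rw [mem_range]
      omega
  · rw [coeff_triangleSeries hd, map_sum]
    exact sum_congr rfl fun a _ => by rw [coeff_monomial]; exact if_congr eq_comm rfl rfl

theorem resSign_natCast_of_le {N i k : ℕ} (hk : 0 < k) (hki : k ≤ i) (hi : 2 * i < N) :
    resSign (i : ZMod N) (k : ZMod N) = if k = i then 1 else 0 := by
  have h1 : (k : ZMod N) = i ↔ k = i := by
    rw [ZMod.natCast_eq_natCast_iff, Nat.ModEq, Nat.mod_eq_of_lt (by omega),
      Nat.mod_eq_of_lt (by omega)]
  have h2 : (k : ZMod N) ≠ -i := by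
    rw [Ne, ← sub_eq_zero, sub_neg_eq_add, ← Nat.cast_add, ZMod.natCast_eq_zero_iff]
    exact fun h => absurd (Nat.le_of_dvd (by omega) h) (by omega)
  simp only [resSign, h1, h2, if_false]

theorem exists_lambertSeries_eq_X_pow_mul {N i : ℕ} (hi0 : 0 < i) (hi : 2 * i < N) :
    ∃ g : ℤ⟦X⟧, lambertSeries (i : ZMod N) = X ^ i * g ∧ constantCoeff g = 1 := by
  have hterm {d : ℕ} (hd : d ≤ i) : ∀ p ∈ {p ∈ d.divisorsAntidiagonal | Odd p.2},
      resSign (i : ZMod N) (p.1 : ZMod N) = if p.1 = i then 1 else 0 := by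
    intro p hp
    have hmem := Nat.mem_divisorsAntidiagonal.1 (mem_filter.1 hp).1
    have hdvd : p.1 ∣ d := ⟨p.2, hmem.1.symm⟩
    have hle := Nat.le_of_dvd (by omega) hdvd
    exact resSign_natCast_of_le (Nat.pos_of_dvd_of_pos hdvd (by omega)) (by omega) hi
  obtain ⟨g, hg⟩ : X ^ i ∣ lambertSeries (i : ZMod N) := by
    rw [X_pow_dvd_iff]
    intro d hd
    rw [lambertSeries, coeff_mk, sum_congr rfl (hterm hd.le)]
    refine sum_eq_zero fun p hp => if_neg fun h => ?_
    have hmem := Nat.mem_divisorsAntidiagonal.1 (mem_filter.1 hp).1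
    have := Nat.le_of_dvd (by omega) (⟨p.2, hmem.1.symm⟩ : p.1 ∣ d)
    omega
  refine ⟨g, hg, ?_⟩
  have h := congrArg (coeff i) hg
  rw [coeff_X_pow_mul', if_pos le_rfl, Nat.sub_self, coeff_zero_eq_constantCoeff_apply] at h
  rw [← h, lambertSeries, coeff_mk, sum_congr rfl (hterm le_rfl), sum_eq_single (i, 1), if_pos rfl]
  · intro p hp hne
    refine if_neg fun h => hne ?_
    have hmem := Nat.mem_divisorsAntidiagonal.1 (mem_filter.1 hp).1
    refine Prod.ext h ?_
    rw [h] at hmem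
    exact Nat.eq_of_mul_eq_mul_left hi0 (by rw [hmem.1, mul_one])
  · intro h
    simp [hi0.ne'] at h

theorem sum_fin_add_one (m : ℕ) : ∑ i : Fin m, ((i : ℕ) + 1) = m * (m + 1) / 2 := by
  rw [Fin.sum_univ_eq_sum_range (fun i => i + 1), ← add_zero (∑ i ∈ range m, (i + 1)),
    ← sum_range_succ' (fun i => i), sum_range_id, Nat.add_sub_cancel, mul_comm]

theorem prod_lambertSeries (m : ℕ) :
    ∏ i : Fin m, lambertSeries (((i : ℕ) + 1 : ℕ) : ZMod (2 * m + 2)) =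
      X ^ (m * (m + 1) / 2) * expand (2 * m + 2) (by omega) (triangleSeries ^ (2 * m)) := by
  set F : Fin m → ℤ⟦X⟧ := fun i => lambertSeries (((i : ℕ) + 1 : ℕ) : ZMod (2 * m + 2)) with hF
  have hsq : (∏ i, F i) ^ 2 = (X ^ (m * (m + 1) / 2) *
      expand (2 * m + 2) (by omega) (triangleSeries ^ (2 * m))) ^ 2 := by
    have hrev : ∏ i, F (Fin.rev i) = ∏ i, F i := Equiv.prod_comp Fin.revPerm F
    have hpair (i : Fin m) : F i * F (Fin.rev i) =
        X ^ (m + 1) * expand (2 * m + 2) (by omega) triangleSeries ^ 4 := by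
      have hi := i.2
      have hsum : (i : ℕ) + 1 + ((Fin.rev i : ℕ) + 1) = m + 1 := by
        rw [Fin.val_rev]
        omega
      have := lambertSeries_mul (i := i + 1) (j := (Fin.rev i : ℕ) + 1) (N := 2 * m + 2)
        (by omega) (by omega) (by omega)
      exact this.trans (congrArg
        (fun s => X ^ s * expand (2 * m + 2) (by omega) triangleSeries ^ 4) hsum)
    rw [sq]
    nth_rw 2 [← hrev]
    rw [← prod_mul_distrib, prod_congr rfl fun i _ => hpair i, prod_const, card_univ,
      Fintype.card_fin, mul_pow, mul_pow, map_pow, ← pow_mul, ← pow_mul, ← pow_mul, ← pow_mul,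
      mul_comm (m * (m + 1) / 2) 2, two_mul_triangle, mul_comm (m + 1) m]
    ring
  choose g hg hg0 using fun i : Fin m => exists_lambertSeries_eq_X_pow_mul (N := 2 * m + 2)
    (i := i + 1) (by omega) (by have := i.2; omega)
  have hFg : ∏ i, F i = X ^ (m * (m + 1) / 2) * ∏ i, g i := by
    rw [prod_congr rfl fun i _ => hg i, prod_mul_distrib, prod_pow_eq_pow_sum, sum_fin_add_one]
  rcases sq_eq_sq_iff_eq_or_eq_neg.1 hsq with h | h
  · exact h
  · rw [hFg, ← mul_neg] at h
    have h' := congrArg constantCoeff (mul_left_cancel₀ (pow_ne_zero _ X_ne_zero) h)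
    rw [map_prod, prod_congr rfl fun i _ => hg0 i, prod_const_one, map_neg, constantCoeff_expand,
      map_pow, constantCoeff_triangleSeries, one_pow] at h'
    omega

theorem prod_resSign {ι : Type*} [Fintype ι] {N : ℕ} (c k : ι → ZMod N) (hc : ∀ i, c i ≠ -c i)
    (hk : ∀ i, k i = c i ∨ k i = -c i) :
    ∏ i, resSign (c i) (k i) = (-1) ^ #{i | k i = -c i} := by
  have h (i : ι) : resSign (c i) (k i) = if k i = -c i then -1 else 1 := by
    rcases hk i with h | h
    · simp [resSign, h, hc i]
    · simp [resSign, h, (hc i).symm]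
  simp_rw [h]
  rw [prod_ite, prod_const, prod_const_one, mul_one]

theorem getz_mahlburg_two_m_odd_case (m x : ℕ) (hm : 0 < m) :
    ((if 2 * m + 2 ∣ x then triangleReps (2 * m) (x / (2 * m + 2)) else 0 : ℕ) : ℤ) =
      ∑ᶠ p : {kl : (Fin m → ℕ) × (Fin m → ℕ) //
          (∀ i, 0 < kl.1 i) ∧ (∀ i, Odd (kl.2 i)) ∧
          (∑ i, kl.1 i * kl.2 i) = m * (m + 1) / 2 + x ∧
          ∀ i : Fin m, ((kl.1 i : ZMod (2 * m + 2)) = (((i : ℕ) + 1 : ℕ) : ZMod (2 * m + 2)) ∨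
            (kl.1 i : ZMod (2 * m + 2)) = -(((i : ℕ) + 1 : ℕ) : ZMod (2 * m + 2)))},
        (-1 : ℤ) ^ (Finset.univ.filter (fun i : Fin m =>
          ((p : (Fin m → ℕ) × (Fin m → ℕ)).1 i : ZMod (2 * m + 2)) =
            -(((i : ℕ) + 1 : ℕ) : ZMod (2 * m + 2)))).card := by
  set c : Fin m → ZMod (2 * m + 2) := fun i => (((i : ℕ) + 1 : ℕ) : ZMod (2 * m + 2)) with hc
  have hcneg (i : Fin m) : c i ≠ -c i := by
    have := i.2
    rw [Ne, ← sub_eq_zero, sub_neg_eq_add, hc]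
    dsimp only
    rw [← Nat.cast_add, ZMod.natCast_eq_zero_iff]
    exact fun h => absurd (Nat.le_of_dvd (by omega) h) (by omega)
  set n := m * (m + 1) / 2 + x with hn
  have hleft : ((if 2 * m + 2 ∣ x then triangleReps (2 * m) (x / (2 * m + 2)) else 0 : ℕ) : ℤ) =
      coeff n (∏ i, lambertSeries (c i)) := by
    rw [hc, prod_lambertSeries, hn, coeff_X_pow_mul', if_pos (Nat.le_add_right _ _),
      Nat.add_sub_cancel_left]
    split_ifs with h
    · obtain ⟨y, rfl⟩ := h
      rw [coeff_expand_mul, coeff_triangleSeries_pow, Nat.mul_div_cancel_left _ (by omega)]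
    · rw [coeff_expand_of_not_dvd _ _ _ h, Nat.cast_zero]
  rw [hleft, coeff_prod_congr (n := n) fun i d hd => coeff_lambertSeries (c i) hd,
    coeff_prod_sum_monomial]
  set T : Finset (Fin m → ℕ × ℕ) := {p ∈ Fintype.piFinset fun _ => oddPairs n |
    ∑ i, (p i).1 * (p i).2 = n} with hT
  have hset : {kl : (Fin m → ℕ) × (Fin m → ℕ) | (∀ i, 0 < kl.1 i) ∧ (∀ i, Odd (kl.2 i)) ∧
      (∑ i, kl.1 i * kl.2 i) = n ∧ ∀ i, (kl.1 i : ZMod (2 * m + 2)) = c i ∨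
        (kl.1 i : ZMod (2 * m + 2)) = -c i} =
      ↑({p ∈ T | ∀ i, ((p i).1 : ZMod (2 * m + 2)) = c i ∨
        ((p i).1 : ZMod (2 * m + 2)) = -c i}.map
          (Equiv.arrowProdEquivProdArrow (Fin m) (fun _ => ℕ) (fun _ => ℕ)).toEmbedding) := by
    ext ⟨k, l⟩
    rw [mem_coe, mem_map_equiv]
    simp only [hT, oddPairs, Set.mem_ofPred_eq, mem_filter, Fintype.mem_piFinset, mem_product,
      mem_Icc, Equiv.arrowProdEquivProdArrow, Equiv.coe_fn_symm_mk]
    constructor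
    · rintro ⟨hk, hl, hsum, hr⟩
      refine ⟨⟨fun i => ?_, hsum⟩, hr⟩
      have h1 := single_le_sum (f := fun i => k i * l i) (fun _ _ => Nat.zero_le _) (mem_univ i)
      have h2 := Nat.le_mul_of_pos_right (k i) (hl i).pos
      have h3 := Nat.le_mul_of_pos_left (l i) (hk i)
      simp only [hsum] at h1
      exact ⟨⟨⟨hk i, by omega⟩, (hl i).pos, by omega⟩, hl i⟩
    · rintro ⟨⟨h, hsum⟩, hr⟩
      exact ⟨fun i => (h i).1.1.1, fun i => (h i).2, hsum, hr⟩
  have hsum := finsum_mem_coe_finset (fun kl : (Fin m → ℕ) × (Fin m → ℕ) =>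
    (-1 : ℤ) ^ #{i : Fin m | (kl.1 i : ZMod (2 * m + 2)) = -c i})
    ({p ∈ T | ∀ i, ((p i).1 : ZMod (2 * m + 2)) = c i ∨
      ((p i).1 : ZMod (2 * m + 2)) = -c i}.map
        (Equiv.arrowProdEquivProdArrow (Fin m) (fun _ => ℕ) (fun _ => ℕ)).toEmbedding)
  rw [← hset, ← finsum_set_coe_eq_finsum_mem, sum_map] at hsum
  refine Eq.trans ?_ hsum.symm
  rw [← sum_filter_of_ne (s := T) (p := fun p => ∀ i, ((p i).1 : ZMod (2 * m + 2)) = c i ∨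
        ((p i).1 : ZMod (2 * m + 2)) = -c i)]
  · exact sum_congr rfl fun p hp =>
      prod_resSign c (fun i => ((p i).1 : ZMod (2 * m + 2))) hcneg (mem_filter.1 hp).2
  · intro p _ hp i
    by_contra h
    rw [not_or] at h
    exact hp (prod_eq_zero (mem_univ i) (by simp [resSign, h]))
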